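/- Let 0 < ε < a < 1, 0 < δ < 1 and τ ≥ 0 be parameters and let C, F, D, D₀ > 0 be constants. Then there exist constants K′ > 0 and D′ > 0, depending only on a, ε, δ, τ, C, F, D and D₀, such that the following holds: for all vectors ς, η, k, ℓ, h ∈ ℝ^d with h ≠ 0 satisfying |⟨ς+k, h⟩| ≤ C ⟨ς+k⟩^δ ‖h‖^{−τ}, ‖k‖ ≤ D ⟨ς+k⟩^ε, ‖h‖ ≤ D₀ ⟨ς+k⟩^ε, ‖η−ς‖ ≤ F ⟨η⟩^a, and ‖ℓ‖ ≤ D ⟨η+ℓ⟩^ε, one has ⟨ς+k⟩ ≤ D′ ⟨η+ℓ⟩ and |⟨η+ℓ, h⟩| ≤ K′ ⟨η+ℓ⟩^{max{δ, a+ε(τ+1)}} ‖h‖^{−τ}. -/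

import Mathlib

/-- A positive definite symmetric bilinear form on `ℝ^d`. -/
structure PDForm (d : ℕ) where
  B : (Fin d → ℝ) →ₗ[ℝ] (Fin d → ℝ) →ₗ[ℝ] ℝ
  symm : ∀ x y, B x y = B y x
  posdef : ∀ x, x ≠ 0 → 0 < B x x

namespace PDForm

variable {d : ℕ} (g : PDForm d)

/-- The inner product `⟨·,·⟩` associated with the form. -/
def inn (x y : Fin d → ℝ) : ℝ := g.B x y

/-- The norm `‖·‖` associated with the form. -/
noncomputable def nrm (x : Fin d → ℝ) : ℝ := Real.sqrt (g.inn x x)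

/-- The Japanese bracket `⟨x⟩ = (1+‖x‖²)^{1/2}`. -/
noncomputable def jap (x : Fin d → ℝ) : ℝ := Real.sqrt (1 + g.inn x x)

end PDForm

namespace PDForm

variable {d : ℕ} (g : PDForm d)

lemma inn_self_nonneg (x : Fin d → ℝ) : 0 ≤ g.inn x x := by
  by_cases hx : x = 0
  · simp [inn, hx]
  · exact (g.posdef x hx).le

lemma nrm_nonneg (x : Fin d → ℝ) : 0 ≤ g.nrm x := Real.sqrt_nonneg _

lemma nrm_sq (x : Fin d → ℝ) : g.nrm x ^ 2 = g.inn x x := Real.sq_sqrt (g.inn_self_nonneg x)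

lemma nrm_pos {x : Fin d → ℝ} (hx : x ≠ 0) : 0 < g.nrm x := Real.sqrt_pos.2 (g.posdef x hx)

lemma jap_sq (x : Fin d → ℝ) : g.jap x ^ 2 = 1 + g.inn x x :=
  Real.sq_sqrt (by linarith [g.inn_self_nonneg x])

lemma one_le_jap (x : Fin d → ℝ) : 1 ≤ g.jap x :=
  Real.one_le_sqrt.2 (by linarith [g.inn_self_nonneg x])

lemma nrm_le_jap (x : Fin d → ℝ) : g.nrm x ≤ g.jap x := Real.sqrt_le_sqrt (by linarith)

lemma nrm_neg (x : Fin d → ℝ) : g.nrm (-x) = g.nrm x := by simp [nrm, inn]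

/-- The Cauchy–Schwarz inequality. -/
lemma abs_inn_le (x y : Fin d → ℝ) : |g.inn x y| ≤ g.nrm x * g.nrm y := by
  apply abs_le_of_sq_le_sq _ (mul_nonneg (g.nrm_nonneg x) (g.nrm_nonneg y))
  rw [mul_pow, nrm_sq, nrm_sq]
  by_cases hy : y = 0
  · simp [inn, hy]
  have hq : 0 < g.inn y y := g.posdef y hy
  have h := g.inn_self_nonneg (g.inn y y • x - g.inn x y • y)
  have e : g.inn (g.inn y y • x - g.inn x y • y) (g.inn y y • x - g.inn x y • y)
      = g.inn y y * (g.inn x x * g.inn y y - g.inn x y ^ 2) := by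
    simp only [inn, map_sub, map_smul, LinearMap.sub_apply, LinearMap.smul_apply, smul_eq_mul,
      g.symm y x]
    ring
  rw [e] at h
  linarith [nonneg_of_mul_nonneg_right h hq]

lemma jap_add_le (x y : Fin d → ℝ) : g.jap (x + y) ≤ g.jap x + g.nrm y := by
  have hx := g.one_le_jap x
  have hy := g.nrm_nonneg y
  refine (pow_le_pow_iff_left₀ (zero_le_one.trans (g.one_le_jap _)) (by linarith) two_ne_zero).1 ?_
  have e : g.inn (x + y) (x + y) = g.inn x x + 2 * g.inn x y + g.inn y y := by
    simp only [inn, map_add, LinearMap.add_apply, g.symm y x]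
    ring
  have h1 : g.inn x y ≤ g.jap x * g.nrm y :=
    (le_abs_self _).trans ((g.abs_inn_le x y).trans
      (mul_le_mul_of_nonneg_right (g.nrm_le_jap x) hy))
  rw [jap_sq, e, add_sq, jap_sq, nrm_sq]
  linarith

lemma jap_sub_le (x y : Fin d → ℝ) : g.jap (x - y) ≤ g.jap x + g.nrm y := by
  simpa [sub_eq_add_neg, nrm_neg] using g.jap_add_le x (-y)

end PDForm

/-- A sublinear term in an upper bound for `X` can be absorbed. -/
lemma le_mul_of_le_add_rpow {X Y A D ε : ℝ} (hX : 0 < X) (hY : 1 ≤ Y) (hA : 0 ≤ A) (hD : 0 < D)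
    (hε : ε < 1) (h : X ≤ A * Y + D * X ^ ε) :
    X ≤ (2 * A + (2 * D) ^ (1 / (1 - ε))) * Y := by
  have hp : 0 < (2 * D) ^ (1 / (1 - ε)) := by positivity
  rcases le_total X (2 * (A * Y)) with hc | hc
  · nlinarith
  have h2 : X ≤ 2 * D * X ^ ε := by linarith
  have h3 : X ^ (1 - ε) ≤ 2 * D := by
    rw [Real.rpow_sub hX, Real.rpow_one, div_le_iff₀ (by positivity)]
    exact h2
  have h4 : X ≤ (2 * D) ^ (1 / (1 - ε)) := by
    have := Real.rpow_le_rpow (by positivity) h3 (z := 1 / (1 - ε))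
      (one_div_nonneg.2 (by linarith))
    rwa [← Real.rpow_mul hX.le, mul_one_div_cancel (by linarith), Real.rpow_one] at this
  nlinarith [mul_nonneg hA (by linarith : (0 : ℝ) ≤ Y)]

/-- A bound `X ≤ A * Y` gives a bound of powers with a possibly larger exponent on `Y ≥ 1`. -/
lemma rpow_le_mul_rpow_of_le {X Y A p q : ℝ} (hX : 0 ≤ X) (hY : 1 ≤ Y) (hA : 0 ≤ A) (hp : 0 ≤ p)
    (hpq : p ≤ q) (h : X ≤ A * Y) : X ^ p ≤ A ^ p * Y ^ q := by
  calc X ^ p ≤ (A * Y) ^ p := Real.rpow_le_rpow hX h hp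
    _ = A ^ p * Y ^ p := Real.mul_rpow hA (by linarith)
    _ ≤ A ^ p * Y ^ q := by gcongr

/-- Quantitative comparison of resonance relations at nearby points:
under the stated smallness assumptions there are `K', D' > 0`, depending only on
`a, ε, δ, τ, C, F, D, D₀`, such that `⟨ς+k⟩ ≤ D'⟨η+ℓ⟩` and
`|⟨η+ℓ,h⟩| ≤ K' ⟨η+ℓ⟩^{max(δ, a+ε(τ+1))} ‖h‖^{-τ}`. -/
theorem statement16 (a ε δ τ C F D D0 : ℝ)
    (hε : 0 < ε) (hεa : ε < a) (ha1 : a < 1) (hδ0 : 0 < δ) (hδ1 : δ < 1) (hτ : 0 ≤ τ)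
    (hC : 0 < C) (hF : 0 < F) (hD : 0 < D) (hD0 : 0 < D0) :
    ∃ K' D' : ℝ, 0 < K' ∧ 0 < D' ∧
      ∀ (d : ℕ) (g : PDForm d) (ς η k ℓ h : Fin d → ℝ), h ≠ 0 →
        |g.inn (ς + k) h| ≤ C * (g.jap (ς + k)) ^ δ * (g.nrm h) ^ (-τ) →
        g.nrm k ≤ D * (g.jap (ς + k)) ^ ε →
        g.nrm h ≤ D0 * (g.jap (ς + k)) ^ ε →
        g.nrm (η - ς) ≤ F * (g.jap η) ^ a →
        g.nrm ℓ ≤ D * (g.jap (η + ℓ)) ^ ε →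
        g.jap (ς + k) ≤ D' * g.jap (η + ℓ) ∧
        |g.inn (η + ℓ) h| ≤
          K' * (g.jap (η + ℓ)) ^ (max δ (a + ε * (τ + 1))) * (g.nrm h) ^ (-τ) := by
  set D' : ℝ := 2 * ((1 + F) * (1 + D)) + (2 * D) ^ (1 / (1 - ε))
  have hD'0 : 0 < D' := by positivity
  refine ⟨C * D' ^ δ + (F * (1 + D) ^ a + D + D * D' ^ ε) * (D0 * D' ^ ε) ^ (τ + 1), D',
    by positivity, hD'0, ?_⟩
  intro d g ς η k ℓ h hh hres hk hhX hης hℓ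
  have hX1 := g.one_le_jap (ς + k)
  have hE1 := g.one_le_jap η
  have hY1 := g.one_le_jap (η + ℓ)
  have hN := g.nrm_pos hh
  have hς : g.jap ς ≤ g.jap η + g.nrm (η - ς) := by
    simpa using g.jap_sub_le η (η - ς)
  have hη : g.jap η ≤ g.jap (η + ℓ) + g.nrm ℓ := by
    simpa using g.jap_sub_le (η + ℓ) ℓ
  have hςk := g.jap_add_le ς k
  have hsplit : |g.inn (η + ℓ) h| ≤
      |g.inn (ς + k) h| + (g.nrm (η - ς) + g.nrm ℓ + g.nrm k) * g.nrm h := by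
    have e : g.inn (η + ℓ) h = g.inn (ς + k) h + g.inn (η - ς) h + g.inn ℓ h - g.inn k h := by
      simp only [PDForm.inn, map_add, map_sub, LinearMap.add_apply, LinearMap.sub_apply]
      ring
    rw [e]
    have h1 := g.abs_inn_le (η - ς) h
    have h2 := g.abs_inn_le ℓ h
    have h3 := g.abs_inn_le k h
    have h4 := abs_sub (g.inn (ς + k) h + g.inn (η - ς) h + g.inn ℓ h) (g.inn k h)
    have h5 := abs_add_three (g.inn (ς + k) h) (g.inn (η - ς) h) (g.inn ℓ h)
    linarith
  generalize g.jap (ς + k) = X at *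
  generalize g.jap η = E at *
  generalize g.jap (η + ℓ) = Y at *
  generalize g.nrm h = N at *
  have hEY : E ≤ (1 + D) * Y := by
    have := Real.rpow_le_self_of_one_le hY1 (hεa.trans ha1).le
    nlinarith
  have hςY : g.jap ς ≤ (1 + F) * (1 + D) * Y := by
    have := Real.rpow_le_self_of_one_le hE1 ha1.le
    nlinarith
  have hXY : X ≤ D' * Y :=
    le_mul_of_le_add_rpow (by linarith) hY1 (by positivity) hD (hεa.trans ha1) (by linarith)
  refine ⟨hXY, hsplit.trans ?_⟩
  set m := max δ (a + ε * (τ + 1))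
  have hXδ : X ^ δ ≤ D' ^ δ * Y ^ m :=
    rpow_le_mul_rpow_of_le (by linarith) hY1 hD'0.le hδ0.le (le_max_left _ _) hXY
  have hXε : X ^ ε ≤ D' ^ ε * Y ^ ε :=
    rpow_le_mul_rpow_of_le (by linarith) hY1 hD'0.le hε.le le_rfl hXY
  have hEa : E ^ a ≤ (1 + D) ^ a * Y ^ a :=
    rpow_le_mul_rpow_of_le (by linarith) hY1 (by linarith) (hε.trans hεa).le le_rfl hEY
  have hYε : Y ^ ε ≤ Y ^ a := Real.rpow_le_rpow_of_exponent_le hY1 hεa.le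
  have hsum : g.nrm (η - ς) + g.nrm ℓ + g.nrm k ≤
      (F * (1 + D) ^ a + D + D * D' ^ ε) * Y ^ a := by
    calc g.nrm (η - ς) + g.nrm ℓ + g.nrm k
        ≤ F * ((1 + D) ^ a * Y ^ a) + D * Y ^ a + D * (D' ^ ε * Y ^ a) := by
          refine add_le_add (add_le_add (hης.trans ?_) (hℓ.trans ?_)) (hk.trans ?_)
          · gcongr
          · gcongr
          · gcongr
            exact hXε.trans (by gcongr)
      _ = _ := by ring
  have hNpow : N ^ (τ + 1) ≤ (D0 * D' ^ ε) ^ (τ + 1) * Y ^ (ε * (τ + 1)) := by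
    rw [Real.rpow_mul (by linarith), ← Real.mul_rpow (by positivity) (by positivity)]
    refine Real.rpow_le_rpow hN.le (hhX.trans ?_) (by linarith)
    rw [mul_assoc]
    gcongr
  have hNeq : N = N ^ (τ + 1) * N ^ (-τ) := by
    rw [← Real.rpow_add hN]; simp
  have hYm : Y ^ a * Y ^ (ε * (τ + 1)) ≤ Y ^ m := by
    rw [← Real.rpow_add (by linarith)]
    exact Real.rpow_le_rpow_of_exponent_le hY1 (le_max_right _ _)
  calc |g.inn (ς + k) h| + (g.nrm (η - ς) + g.nrm ℓ + g.nrm k) * N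
      ≤ C * X ^ δ * N ^ (-τ) +
          ((F * (1 + D) ^ a + D + D * D' ^ ε) * Y ^ a) * (N ^ (τ + 1) * N ^ (-τ)) := by
        rw [← hNeq]
        gcongr
    _ ≤ C * (D' ^ δ * Y ^ m) * N ^ (-τ) + ((F * (1 + D) ^ a + D + D * D' ^ ε) * Y ^ a) *
          ((D0 * D' ^ ε) ^ (τ + 1) * Y ^ (ε * (τ + 1)) * N ^ (-τ)) := by
        gcongr
    _ = C * (D' ^ δ * Y ^ m) * N ^ (-τ) + (F * (1 + D) ^ a + D + D * D' ^ ε) *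
          (D0 * D' ^ ε) ^ (τ + 1) * (Y ^ a * Y ^ (ε * (τ + 1))) * N ^ (-τ) := by ring
    _ ≤ C * (D' ^ δ * Y ^ m) * N ^ (-τ) + (F * (1 + D) ^ a + D + D * D' ^ ε) *
          (D0 * D' ^ ε) ^ (τ + 1) * Y ^ m * N ^ (-τ) := by gcongr
    _ = _ := by ring
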